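/- Every continuous self-map of a nonempty compact topological space has an almost periodic point: if X is a nonempty compact topological space and T : X → X is continuous, then there exists x ∈ X such that for every neighborhood U of x there exists b ∈ ℕ such that for every n ∈ ℕ there exists k < b with T^[n+k] x ∈ U. -/

import Mathlib

/-- A continuous self-map of a nonempty compact space has a minimal nonempty closed
forward-invariant set. -/
theorem exists_minimal_isClosed_mapsTo {X : Type*} [TopologicalSpace X] [CompactSpace X]
    [Nonempty X] (T : X → X) :
    ∃ M : Set X, Minimal (fun s : Set X ↦ IsClosed s ∧ s.Nonempty ∧ Set.MapsTo T s s) M := by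
  refine zorn_superset {s : Set X | IsClosed s ∧ s.Nonempty ∧ Set.MapsTo T s s} ?_
  intro c hc hchain
  rcases c.eq_empty_or_nonempty with rfl | hne
  · exact ⟨Set.univ, ⟨isClosed_univ, Set.univ_nonempty, Set.mapsTo_univ T _⟩, by simp⟩
  · have : Nonempty c := hne.to_subtype
    refine ⟨⋂₀ c, ⟨isClosed_sInter fun s hs ↦ (hc hs).1, ?_, ?_⟩,
      fun s hs ↦ Set.sInter_subset_of_mem hs⟩
    · have hdir : DirectedOn (· ⊇ ·) c := fun s hs t ht ↦ (hchain.total hs ht).elim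
        (fun h ↦ ⟨s, hs, subset_rfl, h⟩) (fun h ↦ ⟨t, ht, h, subset_rfl⟩)
      exact IsCompact.nonempty_sInter_of_directed_nonempty_isCompact_isClosed
        hdir (fun s hs ↦ (hc hs).2.1) (fun s hs ↦ (hc hs).1.isCompact)
        (fun s hs ↦ (hc hs).1)
    · exact fun x hx s hs ↦ (hc hs).2.2 (hx s hs)

/-- In a minimal nonempty closed forward-invariant set, every orbit is dense. -/
theorem subset_closure_range_iterate_of_minimal {X : Type*} [TopologicalSpace X]
    {T : X → X} (hT : Continuous T) {M : Set X}
    (hM : Minimal (fun s : Set X ↦ IsClosed s ∧ s.Nonempty ∧ Set.MapsTo T s s) M)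
    {y : X} (hy : y ∈ M) : M ⊆ closure (Set.range fun n : ℕ ↦ T^[n] y) := by
  refine hM.2 ⟨isClosed_closure, (Set.range_nonempty _).closure, ?_⟩ ?_
  · refine Set.MapsTo.closure ?_ hT
    rintro _ ⟨n, rfl⟩
    exact ⟨n + 1, Function.iterate_succ_apply' T n y⟩
  · refine closure_minimal ?_ hM.1.1
    rintro _ ⟨n, rfl⟩
    exact hM.1.2.2.iterate n hy

/-- Every continuous self-map of a nonempty compact topological space has an
almost periodic point. -/
theorem exists_almost_periodic_point (X : Type*) [TopologicalSpace X]
    [CompactSpace X] [Nonempty X] (T : X → X) (hT : Continuous T) :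
    ∃ x : X, ∀ U ∈ nhds x, ∃ b : ℕ, ∀ n : ℕ, ∃ k < b, T^[n + k] x ∈ U := by
  obtain ⟨M, hM⟩ := exists_minimal_isClosed_mapsTo T
  obtain ⟨x, hx⟩ := hM.1.2.1
  refine ⟨x, fun U hU ↦ ?_⟩
  obtain ⟨V, hVU, hV, hxV⟩ := mem_nhds_iff.mp hU
  obtain ⟨t, ht⟩ := hM.1.1.isCompact.elim_finite_subcover (fun k : ℕ ↦ T^[k] ⁻¹' V)
    (fun k ↦ hV.preimage (hT.iterate k)) fun y hy ↦ by
      obtain ⟨_, hz, k, rfl⟩ := mem_closure_iff.mp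
        (subset_closure_range_iterate_of_minimal hT hM hy hx) V hV hxV
      exact Set.mem_iUnion.mpr ⟨k, hz⟩
  refine ⟨t.sup id + 1, fun n ↦ ?_⟩
  obtain ⟨k, hk, hkV⟩ := Set.mem_iUnion₂.mp (ht (hM.1.2.2.iterate n hx))
  refine ⟨k, Nat.lt_succ_of_le (Finset.le_sup (f := id) hk), hVU ?_⟩
  rw [add_comm, Function.iterate_add_apply]
  exact hkV
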